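/- arXiv:1904.07330 — 2 statements merged into one kernel-verified Lean document; each statement's English description precedes it below -/
import Mathlib

section
/- Let b ∈ F and n an integer such that b^{4n}+1 ≠ 0 (with b ≠ 0 if n is negative). Then K((b^{n+1}+b²)(b^{n+1}+bⁿ+b²+1)³/(b^{4n}+1)) = K((b^{n+1}+b²)³(b^{n+1}+bⁿ+b²+1)/(b^{4n}+1)). -/
/-- The Kloosterman sum over `GF(2^m)`: `K(a) = ∑_{x ≠ 0} (-1)^{Tr(a·x + 1/x)}`. -/
noncomputable def Kl (m : ℕ) (a : GaloisField 2 m) : ℤ :=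
  letI := Fintype.ofFinite (GaloisField 2 m)
  letI := Classical.decEq (GaloisField 2 m)
  ∑ x ∈ Finset.univ.erase (0 : GaloisField 2 m),
    (-1 : ℤ) ^ ((Algebra.trace (ZMod 2) (GaloisField 2 m) (a * x + x⁻¹)).val)

section aux

variable {F : Type*} [Field F] [CharP F 2]

theorem aux_uniq (τ : F →+ ZMod 2) (hτ : ∀ x, τ (x ^ 2) = τ x) (A B t1 t2 : F) (hB : B ≠ 0)
    (h1 : t1 ^ 3 + A * t1 + B = 0) (h2 : t2 ^ 3 + A * t2 + B = 0) (hne : t1 ≠ t2) :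
    τ (A ^ 3 / B ^ 2) = τ 1 := by
  have h20 : (2 : F) = 0 := CharTwo.two_eq_zero
  have ht1 : t1 ≠ 0 := by rintro rfl; apply hB; simpa using h1
  have ht2 : t2 ≠ 0 := by rintro rfl; apply hB; simpa using h2
  have hs : t1 + t2 ≠ 0 := by
    intro h; apply hne; linear_combination h - t2 * h20
  have hA : A = t1 ^ 2 + t1 * t2 + t2 ^ 2 := by
    have : (t1 + t2) * (A - (t1 ^ 2 + t1 * t2 + t2 ^ 2)) = 0 := by
      linear_combination h1 + h2 - (t1 ^ 3 + t2 ^ 3 + t1 * t2 ^ 2 + t1 ^ 2 * t2 + B) * h20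
    rcases mul_eq_zero.1 this with h | h
    · exact absurd h hs
    · linear_combination h
  have hB' : B = t1 * t2 * (t1 + t2) := by
    subst hA
    linear_combination h1 - (t1 ^ 3 + t1 ^ 2 * t2 + t1 * t2 ^ 2) * h20
  have key : A ^ 3 / B ^ 2 = 1 + ((t1 / t2) ^ 2 + t1 / t2)
      + ((t2 ^ 2 / (t1 * (t1 + t2))) ^ 2 + (t2 ^ 2 / (t1 * (t1 + t2)))) := by
    rw [hA, hB']
    field_simp
    grind
  rw [key]
  simp only [map_add, hτ, CharTwo.add_self_eq_zero, add_zero]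

theorem aux_exist [Finite F] (τ : F →+ ZMod 2) (hτ : ∀ x, τ (x ^ 2) = τ x) (A B : F) (hB : B ≠ 0)
    (h : τ (A ^ 3 / B ^ 2) ≠ τ 1) : ∃ t, t ^ 3 + A * t + B = 0 := by
  have h20 : (2 : F) = 0 := CharTwo.two_eq_zero
  by_cases hA : A = 0
  · subst hA
    have hinj : Function.Injective (fun x : F => x ^ 3) := by
      intro x y hxy
      by_contra hne
      simp only at hxy
      by_cases hx : x = 0
      · subst hx
        apply hne
        have : y ^ 3 = 0 := by rw [← hxy]; simp
        exact (pow_eq_zero_iff (by norm_num)).1 this |>.symm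
      · exact h (by
          have := aux_uniq τ hτ 0 (x ^ 3) x y (pow_ne_zero _ hx)
            (by linear_combination x ^ 3 * h20) (by linear_combination x ^ 3 * h20 - hxy) hne
          simpa using this)
    obtain ⟨t, ht⟩ := Finite.surjective_of_injective hinj B
    exact ⟨t, by simp only at ht; linear_combination ht + B * h20⟩
  · have hz2 : ∀ p q : ZMod 2, p ≠ q → p + q = 1 := by decide
    let T := {u : F // τ u = 1}
    have hT0 : ∀ u : T, u.1 ≠ 0 := by
      rintro ⟨u, hu⟩ h0
      simp only at h0
      subst h0
      simp at hu
    let f : T → T := fun u => ⟨u.1 + ((u.1⁻¹) ^ 2 + u.1⁻¹), by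
      simp only [map_add, hτ, CharTwo.add_self_eq_zero, add_zero, u.2]⟩
    -- root of the normalised cubic
    have hroot : ∀ (u : T) (D : F), (f u).1 = D + 1 →
        (1 + u.1⁻¹) ^ 3 + D * (1 + u.1⁻¹) + D = 0 := by
      intro u D hD
      have h0 := hT0 u
      have hD' : D = u.1 + ((u.1⁻¹) ^ 2 + u.1⁻¹) + 1 := by
        simp only [f] at hD
        linear_combination -hD - h20
      rw [hD']
      field_simp
      grind
    have hinj : Function.Injective f := by
      intro u v huv
      by_contra hne
      have hu0 := hT0 u
      have hv0 := hT0 v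
      have hne' : (1 + u.1⁻¹) ≠ 1 + v.1⁻¹ := by
        intro h
        apply hne
        exact Subtype.ext (inv_injective (add_left_cancel h))
      have e1 := hroot u ((f u).1 + 1) (by linear_combination -h20)
      have e2 := hroot v ((f u).1 + 1) (by rw [huv]; linear_combination -h20)
      have hfu := (f u).2
      by_cases hD : (f u).1 + 1 = 0
      · rw [hD] at e1 e2
        apply hne'
        have e1' : 1 + u.1⁻¹ = 0 := by simpa using e1
        have e2' : 1 + v.1⁻¹ = 0 := by simpa using e2
        rw [e1', e2']
      · have := aux_uniq τ hτ _ _ _ _ hD e1 e2 hne'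
        have e : ((f u).1 + 1) ^ 3 / ((f u).1 + 1) ^ 2 = (f u).1 + 1 := by
          field_simp
        rw [e, map_add, hfu] at this
        simp at this
    obtain ⟨u, hu⟩ := Finite.surjective_of_injective hinj
      ⟨A ^ 3 / B ^ 2 + 1, by rw [map_add]; exact hz2 _ _ h⟩
    have := hroot u (A ^ 3 / B ^ 2) (by rw [hu])
    refine ⟨B / A * (1 + u.1⁻¹), ?_⟩
    generalize 1 + u.1⁻¹ = z at this
    field_simp at this ⊢
    linear_combination B * this

theorem aux_card [Finite F] (τ : F →+ ZMod 2) (hτ : ∀ x, τ (x ^ 2) = τ x) (a : F)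
    (ha : a ≠ 0) (ha1 : a + 1 ≠ 0) :
    Nat.card {X : F // X ≠ 0 ∧ τ (X + a ^ 3 * (a + 1) / X) = τ a + 1}
    = Nat.card {X : F // X ≠ 0 ∧ τ (X + a * (a + 1) ^ 3 / X) = τ a + 1} := by
  have h20 : (2 : F) = 0 := CharTwo.two_eq_zero
  have hz : ∀ p : ZMod 2, p ≠ p + 1 := by decide
  have hs1 : ∀ X : F, X ≠ 0 → τ (X + a ^ 3 * (a + 1) / X) = τ a + 1 → X + a ^ 2 ≠ 0 := by
    intro X h0 hX h
    have hX' : X = a ^ 2 := by linear_combination h - a ^ 2 * h20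
    subst hX'
    have e : a ^ 2 + a ^ 3 * (a + 1) / a ^ 2 = a + (a ^ 2 + a ^ 2) := by field_simp; ring
    rw [e] at hX
    simp only [map_add, CharTwo.add_self_eq_zero, add_zero] at hX
    exact hz _ hX
  have hs2 : ∀ X : F, X ≠ 0 → τ (X + a ^ 3 * (a + 1) / X) = τ a + 1 → X + a ^ 2 + a ≠ 0 := by
    intro X h0 hX h
    have hX' : X = a * (a + 1) := by linear_combination h - (a ^ 2 + a) * h20
    subst hX'
    have e : a * (a + 1) + a ^ 3 * (a + 1) / (a * (a + 1)) = a + (a ^ 2 + a ^ 2) := by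
      field_simp; ring
    rw [e] at hX
    simp only [map_add, CharTwo.add_self_eq_zero, add_zero] at hX
    exact hz _ hX
  have hval : ∀ X : F, X ≠ 0 → X + a ^ 2 ≠ 0 → X + a ^ 2 + a ≠ 0 →
      τ (X * (X + a ^ 2 + a) ^ 2 / (X + a ^ 2) ^ 2 + a * (a + 1) ^ 3 /
        (X * (X + a ^ 2 + a) ^ 2 / (X + a ^ 2) ^ 2)) = τ (X + a ^ 3 * (a + 1) / X) := by
    intro X h0 h1 h2
    have e1 : X * (X + a ^ 2 + a) ^ 2 / (X + a ^ 2) ^ 2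
        = X + ((a ^ 2 / (X + a ^ 2)) ^ 2 + a ^ 2 / (X + a ^ 2)) := by
      field_simp
      grind
    have e2 : a * (a + 1) ^ 3 / (X * (X + a ^ 2 + a) ^ 2 / (X + a ^ 2) ^ 2)
        = a ^ 3 * (a + 1) / X + ((a * (a + 1) / (X + a ^ 2 + a)) ^ 2
          + (a * (a + 1) / (X + a ^ 2 + a))) := by
      field_simp
      grind
    rw [e2, e1]
    simp only [map_add, hτ, CharTwo.add_self_eq_zero, add_zero]
  have hres : ∀ B : F, B ≠ 0 → τ (B + a * (a + 1) ^ 3 / B) = τ a + 1 →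
      τ ((1 + a ^ 2 + B) ^ 3 / B ^ 2) ≠ τ 1 := by
    intro B hB h
    have e : (1 + a ^ 2 + B) ^ 3 / B ^ 2 = (B + a * (a + 1) ^ 3 / B) + 1 + a ^ 2
        + (((a + 1) ^ 3 / B) + ((a + 1) ^ 3 / B) ^ 2) + ((a + 1) ^ 3 / B
           + (a + 1) ^ 3 / B) + ((1 + a ^ 2) ^ 3 / B ^ 2 + ((a + 1) ^ 3 / B) ^ 2) := by
      field_simp
      grind
    have e' : (1 + a ^ 2) ^ 3 / B ^ 2 = ((a + 1) ^ 3 / B) ^ 2 := by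
      field_simp
      grind
    rw [e, e']
    simp only [map_add, hτ, CharTwo.add_self_eq_zero, add_zero] at h ⊢
    rw [h]
    generalize τ a = p
    generalize τ 1 = q
    revert p q
    decide
  have hcub : ∀ X : F, X + a ^ 2 ≠ 0 →
      (X / (X + a ^ 2)) ^ 3 + (1 + a ^ 2 + X * (X + a ^ 2 + a) ^ 2 / (X + a ^ 2) ^ 2)
       * (X / (X + a ^ 2)) + X * (X + a ^ 2 + a) ^ 2 / (X + a ^ 2) ^ 2 = 0 := by
    intro X h1
    field_simp
    grind
  refine Nat.card_eq_of_bijective (fun X => ⟨X.1 * (X.1 + a ^ 2 + a) ^ 2 / (X.1 + a ^ 2) ^ 2, ?_, ?_⟩) ⟨?_, ?_⟩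
  · obtain ⟨X, h0, hX⟩ := X
    exact div_ne_zero (mul_ne_zero h0 (pow_ne_zero _ (hs2 X h0 hX))) (pow_ne_zero _ (hs1 X h0 hX))
  · obtain ⟨X, h0, hX⟩ := X
    exact (hval X h0 (hs1 X h0 hX) (hs2 X h0 hX)).trans hX
  · rintro ⟨X, h0, hX⟩ ⟨Y, k0, hY⟩ hXY
    simp only [Subtype.mk.injEq] at hXY ⊢
    have p1 := hs1 X h0 hX
    have p2 := hs1 Y k0 hY
    have c1 := hcub X p1
    have c2 := hcub Y p2
    have hB0 : X * (X + a ^ 2 + a) ^ 2 / (X + a ^ 2) ^ 2 ≠ 0 :=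
      div_ne_zero (mul_ne_zero h0 (pow_ne_zero _ (hs2 X h0 hX))) (pow_ne_zero _ p1)
    have r := hres _ hB0 ((hval X h0 p1 (hs2 X h0 hX)).trans hX)
    rw [← hXY] at c2
    by_contra hne
    refine r (aux_uniq τ hτ _ _ _ _ hB0 c1 c2 ?_)
    intro h
    rw [div_eq_div_iff p1 p2] at h
    apply hne
    have : a ^ 2 * (X - Y) = 0 := by linear_combination h
    rcases mul_eq_zero.1 this with h | h
    · exact absurd h (pow_ne_zero _ ha)
    · exact sub_eq_zero.1 h
  · rintro ⟨B, hB, hBt⟩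
    obtain ⟨t, ht⟩ := aux_exist τ hτ _ B hB (hres B hB hBt)
    have ht0 : t ≠ 0 := by rintro rfl; apply hB; simpa using ht
    have ht1 : t + 1 ≠ 0 := by
      intro h
      have : t = 1 := by linear_combination h - h20
      subst this
      have : a ^ 2 = 0 := by linear_combination ht - (1 + B) * h20
      exact ha (by simpa using this)
    have hX0 : a ^ 2 * t / (t + 1) ≠ 0 := div_ne_zero (mul_ne_zero (pow_ne_zero _ ha) ht0) ht1
    have hX1 : a ^ 2 * t / (t + 1) + a ^ 2 = a ^ 2 / (t + 1) := by
      field_simp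
      grind
    have hX1' : a ^ 2 * t / (t + 1) + a ^ 2 ≠ 0 := by
      rw [hX1]; exact div_ne_zero (pow_ne_zero _ ha) ht1
    have hfX : (a ^ 2 * t / (t + 1)) * (a ^ 2 * t / (t + 1) + a ^ 2 + a) ^ 2
        / (a ^ 2 * t / (t + 1) + a ^ 2) ^ 2 = B := by
      rw [hX1]
      field_simp
      grind
    have hX2 : a ^ 2 * t / (t + 1) + a ^ 2 + a ≠ 0 := by
      intro h
      rw [h] at hfX
      apply hB
      rw [← hfX]
      simp
    have hv := hval _ hX0 hX1' hX2
    rw [hfX] at hv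
    exact ⟨⟨a ^ 2 * t / (t + 1), hX0, hv.symm.trans hBt⟩, Subtype.ext hfX⟩

end aux

theorem aux_Kl (m : ℕ) (c : GaloisField 2 m) (ε : ZMod 2) :
    Kl m c = (-1) ^ ε.val * (2 * (Nat.card {X : GaloisField 2 m // X ≠ 0 ∧
      Algebra.trace (ZMod 2) (GaloisField 2 m) (X + c / X) = ε} : ℤ)
      - Nat.card {X : GaloisField 2 m // X ≠ 0}) := by
  classical
  letI := Fintype.ofFinite (GaloisField 2 m)
  have hp : ∀ g e : ZMod 2, (-1 : ℤ) ^ g.val = (-1) ^ e.val * (2 * (if g = e then 1 else 0) - 1) := by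
    decide
  have h1 : Kl m c = ∑ x ∈ Finset.univ.filter (fun x : GaloisField 2 m => x ≠ 0),
      (-1 : ℤ) ^ ((Algebra.trace (ZMod 2) (GaloisField 2 m) (x + c / x)).val) := by
    unfold Kl
    refine Finset.sum_nbij' (fun x => x⁻¹) (fun x => x⁻¹) ?_ ?_ ?_ ?_ ?_
    · intro x hx; simpa using hx
    · intro x hx; simpa using hx
    · intro x hx; simp
    · intro x hx; simp
    · intro x hx
      rw [div_inv_eq_mul, add_comm]
  rw [h1, Finset.sum_congr rfl (fun x _ => hp _ ε), ← Finset.mul_sum, Finset.sum_sub_distrib,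
    ← Finset.mul_sum, Finset.sum_boole, Finset.filter_filter, Nat.card_eq_fintype_card,
    Nat.card_eq_fintype_card, Fintype.card_subtype, Fintype.card_subtype]
  simp

theorem aux_main (m : ℕ) (a : GaloisField 2 m) :
    Kl m (a ^ 3 * (a + 1)) = Kl m (a * (a + 1) ^ 3) := by
  by_cases ha : a = 0
  · subst ha; simp
  by_cases ha1 : a + 1 = 0
  · rw [ha1]; simp
  let τ : GaloisField 2 m →+ ZMod 2 := (Algebra.trace (ZMod 2) (GaloisField 2 m)).toAddMonoidHom
  have hτ : ∀ x, τ (x ^ 2) = τ x := by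
    intro x
    have := Algebra.trace_eq_of_algEquiv
      (FiniteField.frobeniusAlgEquivOfAlgebraic (ZMod 2) (GaloisField 2 m)) x
    simpa [τ] using this
  have := aux_card τ hτ a ha ha1
  rw [aux_Kl m _ (τ a + 1), aux_Kl m (a * (a + 1) ^ 3) (τ a + 1)]
  simp only [τ, LinearMap.toAddMonoidHom_coe] at this ⊢
  rw [this]

theorem kloosterman_bn (m : ℕ) (hm : 0 < m) (b : GaloisField 2 m) (n : ℤ)
    (hb : n < 0 → b ≠ 0) (h : b ^ (4 * n) + 1 ≠ 0) :
    Kl m ((b ^ (n + 1) + b ^ (2 : ℤ)) * (b ^ (n + 1) + b ^ n + b ^ (2 : ℤ) + 1) ^ 3 / (b ^ (4 * n) + 1))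
      = Kl m ((b ^ (n + 1) + b ^ (2 : ℤ)) ^ 3 * (b ^ (n + 1) + b ^ n + b ^ (2 : ℤ) + 1) / (b ^ (4 * n) + 1)) := by
  have h20 : (2 : GaloisField 2 m) = 0 := CharTwo.two_eq_zero
  have e1 : b ^ (n + 1) = b ^ n * b := by
    by_cases h0 : b = 0
    · have : n + 1 ≠ 0 := by
        intro hn
        exact hb (by omega) h0
      rw [h0, zero_zpow _ this, mul_zero]
    · exact zpow_add_one₀ h0 n
  have e4 : b ^ (4 * n) = (b ^ n) ^ 4 := by
    rw [mul_comm, zpow_mul]; norm_cast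
  have e2 : b ^ (2 : ℤ) = b ^ 2 := by norm_cast
  rw [e1, e4, e2]
  rw [e4] at h
  generalize b ^ n = u at h
  have hu4 : u ^ 4 + 1 = (u + 1) ^ 4 := by grind
  rw [hu4] at h ⊢
  have hu : u + 1 ≠ 0 := fun h' => h (by rw [h']; simp)
  have hm := aux_main m ((u * b + b ^ 2) / (u + 1))
  have ha : (u * b + b ^ 2) / (u + 1) + 1 = (u * b + u + b ^ 2 + 1) / (u + 1) := by
    field_simp; ring
  rw [ha] at hm
  convert hm.symm using 2
  · field_simp
  · field_simp
end

section
/- For every b ∈ F with b⁸+b⁴+1 ≠ 0, K((b³+b²)(b³+b+1)³/(b⁸+b⁴+1)) = K((b³+b²)³(b³+b+1)/(b⁸+b⁴+1)). -/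
section
variable {F : Type*} [Field F] [Fintype F] [Algebra (ZMod 2) F]

theorem hz_sq (x : F) : Algebra.trace (ZMod 2) F (x^2) = Algebra.trace (ZMod 2) F x := by
  have h := Algebra.trace_eq_of_algEquiv (FiniteField.frobeniusAlgEquivOfAlgebraic (ZMod 2) F) x
  simpa [FiniteField.frobeniusAlgEquivOfAlgebraic, FiniteField.frobeniusAlgHom_apply, ZMod.card] using h

theorem hz_two {F : Type*} [Field F] [Algebra (ZMod 2) F] : (2 : F) = 0 := by
  have h := congrArg (algebraMap (ZMod 2) F) (show (2 : ZMod 2) = 0 from rfl)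
  rwa [map_ofNat, map_zero] at h

theorem hz_as (h : F) (y : F) : Algebra.trace (ZMod 2) F (y + (h^2 + h)) = Algebra.trace (ZMod 2) F y := by
  rw [map_add, map_add, hz_sq, CharTwo.add_self_eq_zero, add_zero]

theorem hz_h90 (y : F) (hy : Algebra.trace (ZMod 2) F y = 0) : ∃ z : F, z^2 + z = y := by
  let φ : F →ₗ[ZMod 2] F := (FiniteField.frobeniusAlgHom (ZMod 2) F).toLinearMap + LinearMap.id
  have hφ : ∀ z, φ z = z^2 + z := by
    intro z; simp [φ, FiniteField.frobeniusAlgHom_apply, ZMod.card]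
  have h2 := hz_two (F := F)
  have hker : LinearMap.ker φ ≤ Submodule.span (ZMod 2) {(1 : F)} := by
    intro z hz
    rw [LinearMap.mem_ker, hφ] at hz
    have : z * (z + 1) = 0 := by linear_combination hz
    rcases mul_eq_zero.1 this with h | h
    · rw [h]; exact Submodule.zero_mem _
    · have : z = 1 := by linear_combination h - h2
      rw [this]; exact Submodule.mem_span_singleton_self _
  have hk1 : Module.finrank (ZMod 2) (LinearMap.ker φ) ≤ 1 :=
    (Submodule.finrank_mono hker).trans (finrank_span_singleton (one_ne_zero)).le
  have hr := LinearMap.finrank_range_add_finrank_ker φ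
  have hr2 := LinearMap.finrank_range_add_finrank_ker (Algebra.trace (ZMod 2) F)
  have hs : LinearMap.range (Algebra.trace (ZMod 2) F) = ⊤ :=
    LinearMap.range_eq_top.2 (Algebra.trace_surjective _ _)
  rw [hs, finrank_top, Module.finrank_self] at hr2
  have hle : LinearMap.range φ ≤ LinearMap.ker (Algebra.trace (ZMod 2) F) := by
    rintro _ ⟨z, rfl⟩
    rw [LinearMap.mem_ker, hφ]
    simpa using hz_as z 0
  have := Submodule.eq_of_le_of_finrank_le hle (by omega)
  have hy' : y ∈ LinearMap.range φ := by rw [this]; exact hy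
  obtain ⟨z, hz⟩ := hy'
  exact ⟨z, by rw [← hφ, hz]⟩

theorem hz_inj (A u v : F) (hA : A ≠ 0) (hx : u + A ≠ 0) (hu : u ≠ 0) (hv : v ≠ 0)
    (h : (u + A) + A * (u + A) / u^2 = (v + A) + A * (v + A) / v^2) (huv : u ≠ v) :
    Algebra.trace (ZMod 2) F ((u + A) + A^3 * (A+1) / (u+A)^2) = Algebra.trace (ZMod 2) F A := by
  have h2 := hz_two (F := F)
  have huv' : u - v ≠ 0 := sub_ne_zero.2 huv
  have e : u^2*v^2 + A*u*v + A^2*(u+v) = 0 := by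
    field_simp at h
    apply mul_left_cancel₀ huv'
    grind
  rw [← hz_as (u^2 * v / (A * (u+A))) A, ← hz_as (A^2 / (u+A)) (A + _)]
  congr 1
  field_simp
  clear h huv huv' hA hx hu hv
  grind

theorem hz_map (A u : F) (hx : u + A ≠ 0) (hu : u ≠ 0) (hw : u^2 + A ≠ 0) :
    Algebra.trace (ZMod 2) F (((u + A) + A * (u + A) / u^2) + A * (A+1)^3 / ((u + A) + A * (u + A) / u^2)^2)
      = Algebra.trace (ZMod 2) F ((u + A) + A^3 * (A+1) / (u+A)^2) := by
  have h2 := hz_two (F := F)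
  have e : (u + A) + A * (u + A) / u^2 = (u+A) * (u^2+A) / u^2 := by field_simp
  rw [← hz_as (A / u + A * (A+1) / (u^2+A)) (u + A + _), e]
  congr 1
  field_simp
  grind

theorem hz_ne (A u : F) (hA : A ≠ 0) (hx : u + A ≠ 0)
    (h : Algebra.trace (ZMod 2) F ((u + A) + A^3 * (A+1) / (u+A)^2) ≠ Algebra.trace (ZMod 2) F A) :
    u ≠ 0 ∧ u^2 + A ≠ 0 := by
  have h2 := hz_two (F := F)
  constructor
  · rintro rfl
    apply h
    rw [← hz_as A A]
    congr 1
    field_simp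
    grind
  · intro hw
    apply h
    have e : A^3 * (A+1) / (u+A)^2 = A^2 := by
      field_simp
      grind
    rw [e, map_add, hz_sq, ← hz_sq (u+A), show (u+A)^2 = 0 + (A^2+A) by grind, hz_as]
    simp

theorem hz_cube (ht : Algebra.trace (ZMod 2) F (1 : F) ≠ 0) (T : F) : ∃ w : F, w^3 = T := by
  have h1 : Algebra.trace (ZMod 2) F (1 : F) = (Module.finrank (ZMod 2) F : ZMod 2) := by
    have := Algebra.trace_algebraMap (S := F) (1 : ZMod 2)
    simpa using this
  rw [h1] at ht
  have hodd : ¬ 2 ∣ Module.finrank (ZMod 2) F := by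
    rwa [Ne, ZMod.natCast_eq_zero_iff] at ht
  have hc : Fintype.card F = 2 ^ Module.finrank (ZMod 2) F := by
    rw [Module.card_eq_pow_finrank (K := ZMod 2) (V := F), ZMod.card]
  obtain ⟨n, hn⟩ : ∃ n, Module.finrank (ZMod 2) F = 2 * n + 1 := ⟨Module.finrank (ZMod 2) F / 2, by omega⟩
  have hm : Fintype.card F % 3 = 2 := by
    rw [hc, hn, pow_succ, pow_mul, Nat.mul_mod, Nat.pow_mod]; simp
  obtain ⟨k, hk⟩ : ∃ k, Fintype.card F = 3 * k + 2 := ⟨Fintype.card F / 3, by omega⟩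
  have hp := FiniteField.pow_card T
  rw [hk] at hp
  refine ⟨T^(2*k+1), ?_⟩
  calc (T^(2*k+1))^3 = T^(3*k+2) * T^(3*k+1) := by ring
    _ = T * T^(3*k+1) := by rw [hp]
    _ = T^(3*k+2) := by ring
    _ = T := hp

theorem hz_surj (ht : Algebra.trace (ZMod 2) F (1 : F) ≠ 0) (A X : F) (hA : A ≠ 0) (hX : X ≠ 0)
    (h : Algebra.trace (ZMod 2) F (X + A * (A+1)^3 / X^2) = Algebra.trace (ZMod 2) F A + 1) :
    ∃ u : F, u ≠ 0 ∧ u + A ≠ 0 ∧ (u + A) + A * (u + A) / u^2 = X := by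
  have h2 := hz_two (F := F)
  have hp : Algebra.trace (ZMod 2) F ((A+X+1)^3 / X^2) = 0 := by
    have e : (A+X+1)^3 / X^2 = ((X + A * (A+1)^3 / X^2) + (A + 1)) + (((A+1)^2/X)^2 + (A+1)^2/X) := by
      field_simp
      grind
    have h1 : Algebra.trace (ZMod 2) F (1 : F) = 1 := by
      generalize Algebra.trace (ZMod 2) F (1 : F) = y at ht
      revert y; decide
    rw [e, hz_as, map_add, h, map_add, h1, CharTwo.add_self_eq_zero]
  obtain ⟨z, hz⟩ := hz_h90 _ hp
  have hz' : (X*z)^2 + X * (X*z) = (A+X+1)^3 := by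
    field_simp at hz; grind
  obtain ⟨t, htt⟩ : ∃ t : F, t^3 + (A+X+1)*t + X = 0 := by
    by_cases hp0 : A+X+1 = 0
    · obtain ⟨w, hw⟩ := hz_cube ht X
      exact ⟨w, by rw [hp0, hw]; grind⟩
    · obtain ⟨w, hw⟩ := hz_cube ht (X*z)
      have hw0 : w ≠ 0 := by
        rintro rfl
        apply hp0
        rw [← hw] at hz'
        exact pow_eq_zero_iff (n := 3) (by norm_num) |>.1 (by rw [← hz']; ring)
      refine ⟨w + (A+X+1)/w, ?_⟩
      rw [← hw] at hz'
      field_simp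
      grind
  have ht1 : t + 1 ≠ 0 := by
    intro h0
    have : t = 1 := by linear_combination h0 - h2
    subst this
    grind
  have key : (A/(t+1) + A) + A * (A/(t+1) + A) / (A/(t+1))^2 = X := by
    field_simp
    grind
  refine ⟨A/(t+1), div_ne_zero hA ht1, ?_, key⟩
  intro h0
  rw [h0] at key
  simp at key
  exact hX key.symm

open Classical in
noncomputable def hzS (C : F) (e : ZMod 2) : Finset F :=
  Finset.univ.filter fun x => x ≠ 0 ∧ Algebra.trace (ZMod 2) F (x + C / x^2) = e

theorem hz_le (A : F) (hA : A ≠ 0) :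
    (hzS (A^3*(A+1)) (Algebra.trace (ZMod 2) F A + 1)).card ≤
      (hzS (A*(A+1)^3) (Algebra.trace (ZMod 2) F A + 1)).card := by
  have h2 := hz_two (F := F)
  have hne : Algebra.trace (ZMod 2) F A + 1 ≠ Algebra.trace (ZMod 2) F A := by simp
  have hs : ∀ x : F, (x + A) + A = x := by intro x; grind
  apply Finset.card_le_card_of_injOn (fun x => x + A * x / (x+A)^2)
  · intro x hx
    simp only [hzS, Finset.coe_filter, Finset.mem_univ, true_and, Set.mem_ofPred_eq] at hx ⊢
    obtain ⟨hx0, hx⟩ := hx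
    obtain ⟨u, rfl⟩ : ∃ u, x = u + A := ⟨x + A, (hs x).symm⟩
    obtain ⟨hu, hw⟩ := hz_ne A u hA hx0 (by rw [hx]; exact hne)
    have hm := hz_map A u hx0 hu hw
    rw [hs]
    refine ⟨?_, by rw [hm, hx]⟩
    rw [show (u + A) + A * (u + A) / u^2 = (u+A) * (u^2+A) / u^2 by field_simp]
    positivity
  · intro x hx y hy hxy
    simp only [hzS, Finset.coe_filter, Finset.mem_univ, true_and, Set.mem_ofPred_eq] at hx hy hxy
    obtain ⟨hx0, hx⟩ := hx
    obtain ⟨hy0, hy⟩ := hy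
    obtain ⟨u, rfl⟩ : ∃ u, x = u + A := ⟨x + A, (hs x).symm⟩
    obtain ⟨v, rfl⟩ : ∃ u, y = u + A := ⟨y + A, (hs y).symm⟩
    rw [hs, hs] at hxy
    by_contra hc
    obtain ⟨hu, hw⟩ := hz_ne A u hA hx0 (by rw [hx]; exact hne)
    obtain ⟨hv, hw⟩ := hz_ne A v hA hy0 (by rw [hy]; exact hne)
    have := hz_inj A u v hA hx0 hu hv hxy (fun h => hc (by rw [h]))
    exact hne (hx.symm.trans this)

theorem hz_ge (ht : Algebra.trace (ZMod 2) F (1 : F) ≠ 0) (A : F) (hA : A ≠ 0) :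
    (hzS (A*(A+1)^3) (Algebra.trace (ZMod 2) F A + 1)).card ≤
    (hzS (A^3*(A+1)) (Algebra.trace (ZMod 2) F A + 1)).card := by
  have h2 := hz_two (F := F)
  have hs : ∀ x : F, (x + A) + A = x := by intro x; grind
  apply Finset.card_le_card_of_surjOn (fun x => x + A * x / (x+A)^2)
  intro X hX
  simp only [hzS, Finset.coe_filter, Finset.mem_univ, true_and, Set.mem_ofPred_eq] at hX
  obtain ⟨hX0, hX⟩ := hX
  obtain ⟨u, hu, hx, e⟩ := hz_surj ht A X hA hX0 hX
  have hw : u^2 + A ≠ 0 := by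
    intro h0
    apply hX0
    rw [← e, show (u + A) + A * (u + A) / u^2 = (u+A) * (u^2+A) / u^2 by field_simp, h0]
    simp
  refine ⟨u + A, ?_, ?_⟩
  · simp only [hzS, Finset.coe_filter, Finset.mem_univ, true_and, Set.mem_ofPred_eq]
    refine ⟨hx, ?_⟩
    rw [← hz_map A u hx hu hw, e, hX]
  · simp only [hs, e]

theorem hz_eq (A : F) : ∃ e,
    (hzS (A^3*(A+1)) e).card = (hzS (A*(A+1)^3) e).card := by
  have h2 := hz_two (F := F)
  by_cases hA : A = 0
  · exact ⟨0, by simp [hA]⟩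
  by_cases hA1 : A + 1 = 0
  · exact ⟨0, by simp [hA1]⟩
  refine ⟨Algebra.trace (ZMod 2) F A + 1, le_antisymm (hz_le A hA) ?_⟩
  by_cases ht : Algebra.trace (ZMod 2) F (1 : F) = 0
  · have := hz_le (A+1) hA1
    rw [map_add, ht, add_zero, show A + 1 + 1 = A by grind] at this
    rwa [mul_comm, mul_comm A, mul_comm ((A+1)^3), mul_comm (A+1)] at *
  · exact hz_ge ht A hA

theorem hz_compl (C : F) : (hzS C 0).card + (hzS C 1).card = Fintype.card F - 1 := by
  classical
  rw [← Finset.card_univ, ← Finset.card_erase_of_mem (Finset.mem_univ (0:F)),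
    ← Finset.card_union_of_disjoint]
  · congr 1
    ext x
    simp only [hzS, Finset.mem_union, Finset.mem_filter, Finset.mem_univ, true_and, Finset.mem_erase]
    generalize Algebra.trace (ZMod 2) F _ = y
    have : ∀ y : ZMod 2, y = 0 ∨ y = 1 := by decide
    have := this y
    tauto
  · rw [Finset.disjoint_left]
    intro x hx hy
    simp only [hzS, Finset.mem_filter] at hx hy
    have := hx.2.2.symm.trans hy.2.2
    revert this; decide
end

theorem hz_sum {F : Type*} [Field F] [Fintype F] [Algebra (ZMod 2) F] [DecidableEq F] (c : F) :
    ∑ x ∈ Finset.univ.erase (0 : F), (-1 : ℤ) ^ ((Algebra.trace (ZMod 2) F (c * x + x⁻¹)).val)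
     = ((hzS (c^2) 0).card : ℤ) - (hzS (c^2) 1).card := by
  have e1 : ∑ x ∈ Finset.univ.erase (0 : F), (-1 : ℤ) ^ ((Algebra.trace (ZMod 2) F (c * x + x⁻¹)).val)
     = ∑ x ∈ Finset.univ.erase (0 : F), (-1 : ℤ) ^ ((Algebra.trace (ZMod 2) F (x + c^2/x^2)).val) := by
    refine Finset.sum_bij' (fun x _ => x⁻¹) (fun x _ => x⁻¹) ?_ ?_ ?_ ?_ ?_
    · simp
    · simp
    · simp
    · simp
    · intro x _
      congr 2
      rw [← div_pow, map_add, map_add, hz_sq, div_inv_eq_mul, add_comm]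
  rw [e1]
  have e2 : ∀ x ∈ Finset.univ.erase (0:F), (-1 : ℤ) ^ ((Algebra.trace (ZMod 2) F (x + c^2/x^2)).val)
      = (if x ∈ hzS (c^2) 0 then 1 else 0) - (if x ∈ hzS (c^2) 1 then 1 else 0) := by
    intro x hx
    simp only [Finset.mem_erase] at hx
    simp only [hzS, Finset.mem_filter, Finset.mem_univ, true_and, hx.1, ne_eq, not_false_eq_true]
    generalize Algebra.trace (ZMod 2) F _ = y
    revert y; decide
  rw [Finset.sum_congr rfl e2, Finset.sum_sub_distrib, Finset.sum_ite_mem, Finset.sum_ite_mem]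
  have e3 : ∀ e, Finset.univ.erase (0:F) ∩ hzS (c^2) e = hzS (c^2) e := by
    intro e
    apply Finset.inter_eq_right.2
    intro x hx
    simp only [hzS, Finset.mem_filter] at hx
    simp [hx.2.1]
  simp [e3]

theorem hz_Kl (m : ℕ) (a : GaloisField 2 m) : Kl m (a * (a+1)^3) = Kl m (a^3 * (a+1)) := by
  let _ := Fintype.ofFinite (GaloisField 2 m)
  let _ := Classical.decEq (GaloisField 2 m)
  have h2 := hz_two (F := GaloisField 2 m)
  unfold Kl
  rw [hz_sum, hz_sum]
  have e1 : (a * (a+1)^3)^2 = a^2 * (a^2+1)^3 := by grind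
  have e2 : (a^3 * (a+1))^2 = (a^2)^3 * (a^2+1) := by grind
  rw [e1, e2]
  have h3 := hz_compl (a^2 * (a^2+1)^3)
  have h4 := hz_compl ((a^2)^3 * (a^2+1))
  obtain ⟨e, he⟩ := hz_eq (a^2)
  have : e = 0 ∨ e = 1 := (show ∀ y : ZMod 2, y = 0 ∨ y = 1 by decide) e
  rcases this with rfl | rfl <;> omega

theorem cor5 (m : ℕ) (hm : 0 < m) (b : GaloisField 2 m)
    (hb : b ^ 8 + b ^ 4 + 1 ≠ 0) :
    Kl m ((b ^ 3 + b ^ 2) * (b ^ 3 + b + 1) ^ 3 / (b ^ 8 + b ^ 4 + 1))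
      = Kl m ((b ^ 3 + b ^ 2) ^ 3 * (b ^ 3 + b + 1) / (b ^ 8 + b ^ 4 + 1)) := by
  have h2 := hz_two (F := GaloisField 2 m)
  have hd : b ^ 8 + b ^ 4 + 1 = (b^2+b+1)^4 := by grind
  rw [hd] at hb ⊢
  have h0 : b^2+b+1 ≠ 0 := by rintro h; apply hb; rw [h]; simp
  have h1 : (b^3+b^2)/(b^2+b+1) + 1 = (b^3+b+1)/(b^2+b+1) := by
    field_simp; grind
  have := hz_Kl m ((b^3+b^2)/(b^2+b+1))
  rw [h1] at this
  convert this using 2 <;> field_simp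
end
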